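/- For every real ε > 0 there exists a constant C_ε > 0 such that for every prime p > 2 and every integer c with gcd(c, p) = 1, there exist a point (x, y) ∈ H_p^c, a prime number h, and a positive integer k which is a product of two distinct primes, with 1 ≤ h, k ≤ C_ε · p^{1/4} · exp((log p)^{1/2+ε}), such that (x + h)(y + k) ≡ c (mod p). -/

import Mathlib

/-- The modular hyperbola `H_p^c`: pairs `(x, y)` with `0 ≤ x, y ≤ p - 1` and
`x * y ≡ c (mod p)`. -/
def ModularHyperbola (p : ℕ) (c : ℤ) : Set (ℤ × ℤ) :=
  {q : ℤ × ℤ | 0 ≤ q.1 ∧ q.1 ≤ (p : ℤ) - 1 ∧ 0 ≤ q.2 ∧ q.2 ≤ (p : ℤ) - 1 ∧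
    q.1 * q.2 ≡ c [ZMOD (p : ℤ)]}

section Stepanov

open Polynomial

variable {K : Type*} [Field K]

/-- The operator `r ↦ e f' r + f r'`, so that `(f ^ e * r)' = f ^ (e - 1) * twistedDeriv f e r`. -/
noncomputable def twistedDeriv (f : K[X]) (e : ℕ) : K[X] →ₗ[K] K[X] :=
  LinearMap.mulLeft K ((e : K[X]) * derivative f) + LinearMap.mulLeft K f ∘ₗ derivative

/-- The `k`-fold composition `twistedDeriv f (e - k + 1) ∘ ⋯ ∘ twistedDeriv f e`. -/
noncomputable def iterTwistedDeriv (f : K[X]) : ℕ → ℕ → K[X] →ₗ[K] K[X]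
  | 0, _ => LinearMap.id
  | k + 1, e => iterTwistedDeriv f k (e - 1) ∘ₗ twistedDeriv f e

lemma iterate_derivative_pow_mul (f : K[X]) {k e : ℕ} (h : k ≤ e) (r : K[X]) :
    derivative^[k] (f ^ e * r) = f ^ (e - k) * iterTwistedDeriv f k e r := by
  induction k generalizing e r with
  | zero => simp [iterTwistedDeriv]
  | succ k ih =>
    obtain ⟨e, rfl⟩ : ∃ n, e = n + 1 := ⟨e - 1, by omega⟩
    have : derivative (f ^ (e + 1) * r) = f ^ e * twistedDeriv f (e + 1) r := by
      simp [twistedDeriv, derivative_pow]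
      ring
    rw [Function.iterate_succ_apply, this, ih (by omega)]
    simp [iterTwistedDeriv]

lemma twistedDeriv_mem_degreeLT {f : K[X]} {d : ℕ} (hf : f.natDegree ≤ d) (e : ℕ) {n : ℕ}
    {r : K[X]} (hr : r ∈ degreeLT K n) : twistedDeriv f e r ∈ degreeLT K (n + d) := by
  rcases eq_or_ne r 0 with rfl | h0
  · simp
  have hr' : r.natDegree < n := by
    rw [mem_degreeLT] at hr
    exact (natDegree_lt_iff_degree_lt h0).2 hr
  have h1 : (((e : K[X]) * derivative f) * r).natDegree ≤ d + r.natDegree := by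
    refine natDegree_mul_le.trans (Nat.add_le_add_right (natDegree_mul_le.trans ?_) _)
    have := natDegree_derivative_le f
    simp
    omega
  have h2 : (f * derivative r).natDegree ≤ d + r.natDegree := by
    refine natDegree_mul_le.trans ?_
    have := natDegree_derivative_le r
    omega
  rw [mem_degreeLT]
  refine lt_of_le_of_lt degree_le_natDegree ?_
  have := natDegree_add_le_of_degree_le h1 h2
  simp only [twistedDeriv, LinearMap.add_apply, LinearMap.mulLeft_apply, LinearMap.comp_apply]
  exact_mod_cast (by omega : _ < n + d)

lemma iterTwistedDeriv_mem_degreeLT {f : K[X]} {d : ℕ} (hf : f.natDegree ≤ d) (k e : ℕ) {n : ℕ}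
    {r : K[X]} (hr : r ∈ degreeLT K n) : iterTwistedDeriv f k e r ∈ degreeLT K (n + k * d) := by
  induction k generalizing e r n with
  | zero => simpa [iterTwistedDeriv] using hr
  | succ k ih =>
    have := ih (e - 1) (twistedDeriv_mem_degreeLT hf e hr)
    rw [iterTwistedDeriv, LinearMap.comp_apply]
    convert this using 2
    ring

lemma card_mul_le_natDegree_of_le_rootMultiplicity {R : K[X]} (hR : R ≠ 0) (Z : Finset K) {l : ℕ}
    (h : ∀ z ∈ Z, l ≤ R.rootMultiplicity z) : Z.card * l ≤ R.natDegree := by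
  classical
  calc Z.card * l = ∑ _z ∈ Z, l := by simp
    _ ≤ ∑ z ∈ Z, R.roots.count z := Finset.sum_le_sum fun z hz => by
        rw [count_roots]; exact h z hz
    _ ≤ ∑ z ∈ Z ∪ R.roots.toFinset, R.roots.count z :=
        Finset.sum_le_sum_of_subset Finset.subset_union_left
    _ = R.roots.card := Multiset.sum_count_eq_card fun a ha => by simp_all
    _ ≤ R.natDegree := card_roots' R

/-- The monic polynomial with simple roots exactly at the points of `S`. -/
noncomputable def rootPoly (S : Finset K) : K[X] := ∏ s ∈ S, (X - C s)

lemma natDegree_rootPoly (S : Finset K) : (rootPoly S).natDegree = S.card := by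
  rw [rootPoly, natDegree_prod_of_monic _ _ fun s _ => monic_X_sub_C s]
  simp

lemma rootPoly_ne_zero (S : Finset K) : rootPoly S ≠ 0 :=
  (monic_prod_of_monic _ _ fun s _ => monic_X_sub_C s).ne_zero

lemma rootMultiplicity_rootPoly {S : Finset K} {s : K} (hs : s ∈ S) :
    (rootPoly S).rootMultiplicity s = 1 := by
  classical
  rw [← count_roots, rootPoly, roots_prod_X_sub_C, Multiset.count_eq_one_of_mem S.nodup hs]

lemma eq_zero_of_sq_mul_rootPoly_eq {S : Finset K} (hS : S.Nonempty) {b : K} (hb : b ≠ 0)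
    {r s : K[X]} (h : r ^ 2 * rootPoly S = C b * s ^ 2) : r = 0 ∧ s = 0 := by
  classical
  have hb' : (C b : K[X]) ≠ 0 := by simpa
  by_cases hr : r = 0
  · subst hr
    simpa [hb] using h.symm
  exfalso
  have hs : s ≠ 0 := by
    rintro rfl
    simp [hr, rootPoly_ne_zero] at h
  obtain ⟨t, ht⟩ := hS
  have h1 := congrArg (rootMultiplicity t) h
  rw [rootMultiplicity_mul (mul_ne_zero (pow_ne_zero _ hr) (rootPoly_ne_zero S)),
    rootMultiplicity_mul (mul_ne_zero hb' (pow_ne_zero _ hs)), rootMultiplicity_rootPoly ht,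
    rootMultiplicity_C, ← count_roots (r ^ 2), ← count_roots (s ^ 2), roots_pow, roots_pow,
    Multiset.count_nsmul, Multiset.count_nsmul] at h1
  omega

variable {p : ℕ} [Fact p.Prime]

lemma X_pow_dvd_pow_sub_C (f : (ZMod p)[X]) : X ^ p ∣ f ^ p - C (f.eval 0) := by
  have : X ∣ f - C (f.eval 0) := by
    simpa using X_sub_C_dvd_sub_C_eval (p := f) (a := 0)
  obtain ⟨g, hg⟩ := this
  refine ⟨expand (ZMod p) p g, ?_⟩
  have := congrArg (expand (ZMod p) p) hg
  rwa [map_sub, map_mul, expand_C, expand_X, ZMod.expand_card] at this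

lemma eq_zero_of_X_pow_dvd {S : Finset (ZMod p)} (hS : S.Nonempty) (h0 : (0 : ZMod p) ∉ S)
    {c A : ℕ} (hc : 2 * c + 1 = p) (hA : 2 * A + S.card ≤ p) {r s : (ZMod p)[X]}
    (hr : r ∈ degreeLT (ZMod p) A) (hs : s ∈ degreeLT (ZMod p) A)
    (h : X ^ p ∣ r + s * rootPoly S ^ c) : r = 0 ∧ s = 0 := by
  set f := rootPoly S with hf
  have hb : f.eval 0 ≠ 0 := by
    simp only [hf, rootPoly, eval_prod, Finset.prod_ne_zero_iff]
    rintro x hx h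
    apply h0
    simp at h
    rwa [← h]
  refine eq_zero_of_sq_mul_rootPoly_eq hS hb ?_
  have h1 : X ^ p ∣ r ^ 2 * f - C (f.eval 0) * s ^ 2 := by
    have : r ^ 2 * f - C (f.eval 0) * s ^ 2 =
        (r + s * f ^ c) * ((r - s * f ^ c) * f) + (f ^ p - C (f.eval 0)) * s ^ 2 := by
      have : f ^ p = f ^ c * f ^ c * f := by
        rw [← pow_add, ← pow_succ]
        congr 1
        omega
      rw [this]
      ring
    rw [this]
    exact dvd_add (h.mul_right _) ((X_pow_dvd_pow_sub_C f).mul_right _)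
  have hp := (Fact.out : p.Prime).pos
  have hA0 : ∀ {q : (ZMod p)[X]}, q ∈ degreeLT (ZMod p) A → 2 * q.natDegree + S.card < p := by
    intro q hq
    rcases eq_or_ne q 0 with rfl | hq0
    · have : S.card < p := by
        have : S ⊂ Finset.univ := Finset.ssubset_univ_iff.2 fun h => h0 (h ▸ Finset.mem_univ _)
        simpa [ZMod.card] using Finset.card_lt_card this
      simpa
    · rw [mem_degreeLT] at hq
      have := (natDegree_lt_iff_degree_lt hq0).2 hq
      omega
  have hd : (r ^ 2 * f - C (f.eval 0) * s ^ 2).natDegree < p := by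
    have e1 : (r ^ 2 * f).natDegree ≤ 2 * r.natDegree + S.card :=
      natDegree_mul_le.trans (Nat.add_le_add natDegree_pow_le (natDegree_rootPoly S).le)
    have e2 : (C (f.eval 0) * s ^ 2).natDegree ≤ 2 * s.natDegree :=
      (natDegree_C_mul_le _ _).trans natDegree_pow_le
    have e3 := natDegree_sub_le (r ^ 2 * f) (C (f.eval 0) * s ^ 2)
    have := hA0 hr
    have := hA0 hs
    omega
  by_contra hne
  have hne' := sub_ne_zero.2 hne
  have := natDegree_le_of_dvd h1 hne'
  rw [natDegree_X_pow] at this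
  omega

lemma eq_zero_of_sum_mul_X_pow_eq_zero {S : Finset (ZMod p)} (hS : S.Nonempty)
    (h0 : (0 : ZMod p) ∉ S) {c A : ℕ} (hc : 2 * c + 1 = p) (hA : 2 * A + S.card ≤ p) (J : ℕ)
    {r s : ℕ → (ZMod p)[X]} (hr : ∀ j, r j ∈ degreeLT (ZMod p) A)
    (hs : ∀ j, s j ∈ degreeLT (ZMod p) A)
    (h : ∑ j ∈ Finset.range J, (r j + s j * rootPoly S ^ c) * X ^ (p * j) = 0) :
    ∀ j < J, r j = 0 ∧ s j = 0 := by
  induction J generalizing r s with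
  | zero => simp
  | succ J ih =>
    have e : ∑ j ∈ Finset.range J,
        (r (j + 1) + s (j + 1) * rootPoly S ^ c) * X ^ (p * (j + 1)) =
        X ^ p * ∑ j ∈ Finset.range J,
          (r (j + 1) + s (j + 1) * rootPoly S ^ c) * X ^ (p * j) := by
      rw [Finset.mul_sum]
      exact Finset.sum_congr rfl fun j _ => by ring
    rw [Finset.sum_range_succ', e] at h
    simp only [mul_zero, pow_zero, mul_one] at h
    have hz : r 0 = 0 ∧ s 0 = 0 := by
      refine eq_zero_of_X_pow_dvd hS h0 hc hA (hr 0) (hs 0) ?_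
      rw [eq_neg_of_add_eq_zero_right h]
      exact (dvd_mul_right _ _).neg_right
    rw [hz.1, hz.2, zero_mul, add_zero, add_zero] at h
    have h' := (mul_eq_zero.1 h).resolve_left (pow_ne_zero _ X_ne_zero)
    have := ih (fun j => hr (j + 1)) (fun j => hs (j + 1)) h'
    rintro (_ | j) hj
    · exact hz
    · exact this j (by omega)

lemma finrank_degreeLT (n : ℕ) : Module.finrank K (degreeLT K n) = n := by
  rw [(degreeLTEquiv K n).finrank_eq]; simp

instance finiteDimensional_degreeLT (n : ℕ) : FiniteDimensional K (degreeLT K n) :=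
  (degreeLTEquiv K n).symm.finiteDimensional

lemma exists_auxiliary_coefficients {f : K[X]} {d : ℕ} (hf : f.natDegree ≤ d) (a : K)
    (c : ℕ) {l A J : ℕ} (h : l * (A + l * d + J) < 2 * J * A) :
    ∃ r s : ℕ → K[X], (∀ j, r j ∈ degreeLT K A) ∧ (∀ j, s j ∈ degreeLT K A) ∧
      (∃ j < J, ¬ (r j = 0 ∧ s j = 0)) ∧
      ∀ k < l, ∑ j ∈ Finset.range J,
        (iterTwistedDeriv f k l (r j) + a • iterTwistedDeriv f k (l + c) (s j)) * X ^ j = 0 := by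
  let V := Fin J → degreeLT K A × degreeLT K A
  let ψ (k : Fin l) (j : Fin J) : V →ₗ[K] K[X] :=
    LinearMap.mulRight K (X ^ (j : ℕ)) ∘ₗ
      (iterTwistedDeriv f k l ∘ₗ (degreeLT K A).subtype ∘ₗ LinearMap.fst K _ _ +
        a • iterTwistedDeriv f k (l + c) ∘ₗ (degreeLT K A).subtype ∘ₗ LinearMap.snd K _ _) ∘ₗ
      LinearMap.proj j
  have hψ (k : Fin l) (v : V) : (∑ j, ψ k j) v ∈ degreeLT K (A + l * d + J) := by
    rw [LinearMap.sum_apply]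
    refine Submodule.sum_mem _ fun j _ => ?_
    have hu : ∀ {q : K[X]}, q ∈ degreeLT K A → ∀ e,
        iterTwistedDeriv f k e q ∈ degreeLT K (A + l * d) := fun hq e =>
      degreeLT_mono (by gcongr; exact k.2.le) (iterTwistedDeriv_mem_degreeLT hf k e hq)
    have hm := (degreeLT K _).add_mem (hu (v j).1.2 l) ((degreeLT K _).smul_mem a
      (hu (v j).2.2 (l + c)))
    rw [mem_degreeLT] at hm
    change (_ + _) * X ^ (j : ℕ) ∈ _
    rw [mem_degreeLT]
    refine (degree_mul_le _ _).trans_lt ?_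
    rw [degree_X_pow, Nat.cast_add]
    refine WithBot.add_lt_add_of_lt_of_le (WithBot.natCast_ne_bot _) hm ?_
    exact_mod_cast j.2.le
  let Φ : V →ₗ[K] (Fin l → degreeLT K (A + l * d + J)) :=
    LinearMap.pi fun k => LinearMap.codRestrict _ (∑ j, ψ k j) (hψ k)
  have hlt : Module.finrank K (Fin l → degreeLT K (A + l * d + J)) < Module.finrank K V := by
    simp only [V, Module.finrank_pi_fintype, Module.finrank_prod, finrank_degreeLT,
      Finset.sum_const, Finset.card_univ, Fintype.card_fin, smul_eq_mul]
    linarith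
  obtain ⟨v, hv, hv0⟩ := (Submodule.ne_bot_iff _).1 (LinearMap.ker_ne_bot_of_finrank_lt (f := Φ) hlt)
  refine ⟨fun j => if hj : j < J then (v ⟨j, hj⟩).1 else 0,
    fun j => if hj : j < J then (v ⟨j, hj⟩).2 else 0, fun j => ?_, fun j => ?_, ?_, fun k hk => ?_⟩
  · dsimp only; split_ifs <;> simp
  · dsimp only; split_ifs <;> simp
  · obtain ⟨j, hj⟩ := Function.ne_iff.1 hv0
    refine ⟨j, j.2, fun hz => hj ?_⟩
    have h1 : (v j).1 = 0 := by simpa using hz.1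
    have h2 : (v j).2 = 0 := by simpa using hz.2
    exact Prod.ext h1 h2
  · have h1 : (Φ v) ⟨k, hk⟩ = 0 := by rw [LinearMap.mem_ker.1 hv]; rfl
    have h2 : (∑ j, ψ ⟨k, hk⟩ j) v = 0 := congrArg Subtype.val h1
    rw [LinearMap.sum_apply] at h2
    rw [Finset.sum_range, ← h2]
    refine Finset.sum_congr rfl fun j _ => ?_
    simp only [Fin.is_lt, dite_true]
    rfl

/-- **Stepanov's method**: the number of points where `f ^ ((p - 1) / 2)` takes a given
value. -/
lemma card_mul_le_of_eval_pow_eq {S : Finset (ZMod p)} (hS : S.Nonempty)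
    (h0 : (0 : ZMod p) ∉ S) {c A J l : ℕ} (hc : 2 * c + 1 = p) (hA : 2 * A + S.card ≤ p)
    (hl : l ≤ p) (hdim : l * (A + l * S.card + J) < 2 * J * A) {a : ZMod p}
    (Z : Finset (ZMod p)) (hZ : ∀ z ∈ Z, (rootPoly S).eval z ^ c = a) :
    Z.card * l ≤ l * S.card + A + c * S.card + p * (J - 1) := by
  set f := rootPoly S with hf
  obtain ⟨r, s, hr, hs, ⟨j₀, hj₀, hne⟩, hσ⟩ :=
    exists_auxiliary_coefficients (natDegree_rootPoly S).le a c hdim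
  rw [← hf] at hσ
  set Q := ∑ j ∈ Finset.range J, (r j + s j * f ^ c) * X ^ (p * j) with hQ
  have hQ0 : Q ≠ 0 := fun h =>
    hne (eq_zero_of_sum_mul_X_pow_eq_zero hS h0 hc hA J hr hs h j₀ hj₀)
  have hR0 : f ^ l * Q ≠ 0 := mul_ne_zero (pow_ne_zero _ (rootPoly_ne_zero S)) hQ0
  have hnat : ∀ {q : (ZMod p)[X]}, q ∈ degreeLT (ZMod p) A → q.natDegree ≤ A := fun hq =>
    natDegree_le_of_degree_le (mem_degreeLT.1 hq).le
  have hdeg : (f ^ l * Q).natDegree ≤ l * S.card + A + c * S.card + p * (J - 1) := by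
    have hfd : ∀ n, (f ^ n).natDegree ≤ n * S.card := fun n =>
      natDegree_pow_le.trans_eq (by rw [natDegree_rootPoly])
    have hQd : Q.natDegree ≤ A + c * S.card + p * (J - 1) := by
      refine natDegree_sum_le_of_forall_le _ _ fun j hj => ?_
      refine natDegree_mul_le.trans (Nat.add_le_add ?_ ?_)
      · refine natDegree_add_le_of_degree_le ((hnat (hr j)).trans (by omega)) ?_
        exact natDegree_mul_le.trans (Nat.add_le_add (hnat (hs j)) (hfd c))
      · rw [natDegree_X_pow]
        have := Finset.mem_range.1 hj
        gcongr
        omega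
    have := natDegree_mul_le (p := f ^ l) (q := Q)
    have := hfd l
    omega
  refine (card_mul_le_natDegree_of_le_rootMultiplicity hR0 Z fun z hz => ?_).trans hdeg
  rcases l with _ | n
  · simp
  have hXp : ∀ (k j : ℕ) (g : (ZMod p)[X]),
      derivative^[k] (g * X ^ (p * j)) = derivative^[k] g * X ^ (p * j) := by
    intro k j g
    induction k generalizing g with
    | zero => rfl
    | succ k ih =>
      rw [Function.iterate_succ_apply, Function.iterate_succ_apply, ← ih]
      simp [derivative_X_pow]
  refine lt_rootMultiplicity_of_isRoot_iterate_derivative_of_mem_nonZeroDivisors hR0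
    (fun k hk => ?_) ?_
  · have hkl : k ≤ n + 1 := by omega
    have e : f ^ (n + 1) * Q = ∑ j ∈ Finset.range J,
        (f ^ (n + 1) * r j + f ^ (n + 1 + c) * s j) * X ^ (p * j) := by
      rw [hQ, Finset.mul_sum]
      exact Finset.sum_congr rfl fun j _ => by ring
    have e2 := congrArg (eval z) (hσ k (by omega))
    rw [e, IsRoot.def, iterate_derivative_sum]
    simp only [hXp, iterate_map_add, iterate_derivative_pow_mul f hkl,
      iterate_derivative_pow_mul f (show k ≤ n + 1 + c by omega)]
    rw [eval_finsetSum] at e2 ⊢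
    simp only [eval_add, eval_mul, eval_pow, eval_smul, eval_X, smul_eq_mul, eval_zero] at e2 ⊢
    rw [← mul_zero (f.eval z ^ (n + 1 - k)), ← e2, Finset.mul_sum]
    refine Finset.sum_congr rfl fun j _ => ?_
    rw [pow_mul, ZMod.pow_card, show n + 1 + c - k = n + 1 - k + c by omega, pow_add, hZ z hz]
    ring
  · rw [mem_nonZeroDivisors_iff_ne_zero, Ne, ZMod.natCast_eq_zero_iff,
      (Fact.out : p.Prime).dvd_factorial]
    omega

lemma card_le_of_eval_pow_eq (hp : 100 ≤ p) {S : Finset (ZMod p)} (hS : S.Nonempty)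
    (h0 : (0 : ZMod p) ∉ S) (hcard : 8 * S.card ≤ p) {a : ZMod p} (Z : Finset (ZMod p))
    (hZ : ∀ z ∈ Z, (rootPoly S).eval z ^ (p / 2) = a) :
    (Z.card : ℝ) ≤ p / 2 + 5 * S.card * √p := by
  have hodd : 2 * (p / 2) + 1 = p := by
    have := (Fact.out : p.Prime).eq_two_or_odd
    omega
  have hd := hS.card_pos
  set d := S.card
  obtain ⟨A, hA⟩ : ∃ A, A = (p - d) / 2 := ⟨_, rfl⟩
  obtain ⟨w, hw⟩ : ∃ w, w = p.sqrt / 2 := ⟨_, rfl⟩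
  have hA1 : 2 * A + d ≤ p := by omega
  have hA2 : p ≤ 2 * A + d + 1 := by omega
  have hs := Nat.sqrt_le p
  have hs10 : 10 ≤ p.sqrt := Nat.le_sqrt.2 (by omega)
  have hwp : (2 * w) * (2 * w) ≤ p := (Nat.mul_le_mul (by omega) (by omega)).trans hs
  have hw5 : 5 ≤ w := by omega
  have hdim : 2 * w * (A + 2 * w * d + (w + 2 * d)) < 2 * (w + 2 * d) * A := by
    have h1 : 8 * (2 * w + 1) < p := by
      rcases lt_or_ge w 6 with h | h
      · obtain rfl : w = 5 := by omega
        omega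
      · nlinarith
    have h2 : 2 * (w * w) * d ≤ p * d / 2 := by
      rw [Nat.le_div_iff_mul_le (by norm_num)]; nlinarith
    have h3 : 4 * (w * w) ≤ p * d := by nlinarith
    have h4 : d * p ≤ d * (2 * A + d + 1) := Nat.mul_le_mul_left _ hA2
    have h5 : d * (8 * (2 * w + 1) + 8 * d) < d * (2 * p) := Nat.mul_lt_mul_of_pos_left (by omega) hd
    have h6 : 2 * (2 * (w * w) * d) ≤ p * d := by nlinarith
    nlinarith
  have key := card_mul_le_of_eval_pow_eq hS h0 hodd hA1
    ((Nat.le_mul_self (2 * w)).trans hwp) hdim Z hZ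
  have h10 : 10 ≤ √(p : ℝ) := Real.le_sqrt_of_sq_le (by norm_num; exact_mod_cast hp)
  have hw2 : 2 / 5 * √(p : ℝ) ≤ w := by
    have e1 : √(p : ℝ) < p.sqrt + 1 := by
      rw [Real.sqrt_lt' (by positivity)]
      exact_mod_cast Nat.lt_succ_sqrt' p
    have e2 : (p.sqrt : ℝ) ≤ 2 * w + 1 := by exact_mod_cast (by omega : p.sqrt ≤ 2 * w + 1)
    linarith
  have key2 : (Z.card * (2 * w) : ℝ) ≤ 2 * w * d + p * w + 5 / 2 * p * d := by
    have e1 : Z.card * (2 * w) + p ≤ 2 * w * d + A + p / 2 * d + p * (w + 2 * d) := by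
      obtain ⟨j, hj⟩ : ∃ j, w + 2 * d = j + 1 := ⟨w + 2 * d - 1, by omega⟩
      rw [hj, Nat.add_sub_cancel] at key
      rw [hj]
      linarith
    have e2 : 2 * (Z.card * (2 * w)) ≤ 2 * (2 * w * d + p * w) + 5 * p * d := by
      have : 2 * (p / 2) * d ≤ p * d := Nat.mul_le_mul_right _ (by omega)
      nlinarith
    have e3 : (2 * (Z.card * (2 * w)) : ℝ) ≤ 2 * (2 * w * d + p * w) + 5 * p * d := by
      exact_mod_cast e2
    linarith
  have hdw : √(p : ℝ) * d * (2 / 5 * √p) ≤ √(p : ℝ) * d * w := by gcongr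
  have hdw2 : (d : ℝ) * w * 10 ≤ d * w * √p := by gcongr
  have hwpos : (0 : ℝ) < 2 * w := by positivity
  have hr : (p : ℝ) = √p * √p := (Real.mul_self_sqrt (Nat.cast_nonneg p)).symm
  refine le_of_mul_le_mul_right (key2.trans ?_) hwpos
  have : (5 / 2 * p * d : ℝ) = 25 / 4 * (√(p : ℝ) * d * (2 / 5 * √p)) := by
    nth_rewrite 1 [hr]; ring
  nlinarith

/-- A Weil-type bound for quadratic character sums along polynomials with simple rational roots. -/
lemma abs_sum_quadraticChar_rootPoly_le (hp : 100 ≤ p) {S : Finset (ZMod p)} (hS : S.Nonempty)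
    (h0 : (0 : ZMod p) ∉ S) (hcard : 8 * S.card ≤ p) :
    |∑ z, (quadraticChar (ZMod p) ((rootPoly S).eval z) : ℝ)| ≤ 11 * S.card * √p := by
  classical
  have hchar : ringChar (ZMod p) ≠ 2 := by
    rw [ZMod.ringChar_zmod_n]; omega
  have main : ∀ e : ℤ, e = 1 ∨ e = -1 →
      (e : ℝ) * ∑ z, (quadraticChar (ZMod p) ((rootPoly S).eval z) : ℝ) ≤ 11 * S.card * √p := by
    intro e he
    have hN := card_le_of_eval_pow_eq hp hS h0 hcard (a := (e : ZMod p))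
      {z | quadraticChar (ZMod p) ((rootPoly S).eval z) = e} fun z hz => by
        have := quadraticChar_eq_pow_of_char_ne_two' hchar ((rootPoly S).eval z)
        rw [ZMod.card] at this
        rw [← this, (Finset.mem_filter.1 hz).2]
    have hz0 : (Finset.univ.filter fun z => (rootPoly S).eval z = 0) ⊆ S := by
      intro z hz
      have := (Finset.mem_filter.1 hz).2
      rw [rootPoly, eval_prod, Finset.prod_eq_zero_iff] at this
      obtain ⟨s, hs, hzs⟩ := this
      rw [eval_sub, eval_X, eval_C, sub_eq_zero] at hzs
      rwa [hzs]
    have hz1 : ((Finset.univ.filter fun z => (rootPoly S).eval z = 0).card : ℝ) ≤ S.card := by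
      exact_mod_cast Finset.card_le_card hz0
    have hpt : ∀ z : ZMod p, (e : ℝ) * (quadraticChar (ZMod p) ((rootPoly S).eval z) : ℝ) ≤
        2 * (if quadraticChar (ZMod p) ((rootPoly S).eval z) = e then 1 else 0) - 1 +
          (if (rootPoly S).eval z = 0 then 1 else 0) := by
      intro z
      rcases eq_or_ne ((rootPoly S).eval z) 0 with h | h
      · rw [h]
        rcases he with rfl | rfl <;> simp
      · rcases quadraticChar_dichotomy h with h' | h' <;> rw [h'] <;>
          rcases he with rfl | rfl <;> norm_num [h]
    rw [Finset.mul_sum]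
    refine (Finset.sum_le_sum fun z _ => hpt z).trans ?_
    rw [Finset.sum_add_distrib, Finset.sum_sub_distrib, ← Finset.mul_sum, Finset.sum_boole,
      Finset.sum_boole, Finset.sum_const, Finset.card_univ, ZMod.card, nsmul_one]
    have h1 : 1 ≤ √(p : ℝ) := Real.le_sqrt_of_sq_le (by norm_num; omega)
    have h2 : (S.card : ℝ) * 1 ≤ S.card * √(p : ℝ) := by gcongr
    linarith
  rw [abs_le']
  constructor
  · simpa using main 1 (Or.inl rfl)
  · simpa using main (-1) (Or.inr rfl)

/-- Few points `z` have prescribed quadratic characters `χ (z - v)` for all `v ∈ V`. -/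
lemma two_pow_mul_card_le_of_quadraticChar_eq (hp : 100 ≤ p) {V : Finset (ZMod p)}
    (h0 : (0 : ZMod p) ∉ V) (hcard : 8 * V.card ≤ p) {ε : ZMod p → ℤ}
    (hε : ∀ v ∈ V, ε v = 1 ∨ ε v = -1) (Z : Finset (ZMod p))
    (hZ : ∀ z ∈ Z, ∀ v ∈ V, quadraticChar (ZMod p) (z - v) = ε v) :
    (2 : ℝ) ^ V.card * Z.card ≤ p + 2 ^ V.card * (11 * V.card * √p) := by
  classical
  set χ := quadraticChar (ZMod p)
  have hle : ∀ v ∈ V, ∀ z, (0 : ℝ) ≤ 1 + ε v * χ (z - v) := by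
    intro v hv z
    rcases eq_or_ne (z - v) 0 with h | h
    · simp [h, χ]
    · rcases quadraticChar_dichotomy h with h' | h' <;> rcases hε v hv with h'' | h'' <;>
        simp only [χ, h', h''] <;> norm_num
  have hlow : (2 : ℝ) ^ V.card * Z.card ≤ ∑ z, ∏ v ∈ V, (1 + (ε v : ℝ) * χ (z - v)) := by
    calc (2 : ℝ) ^ V.card * Z.card = ∑ z ∈ Z, ∏ v ∈ V, (1 + (ε v : ℝ) * χ (z - v)) := by
          rw [mul_comm, ← nsmul_eq_mul, ← Finset.sum_const]
          refine Finset.sum_congr rfl fun z hz => ?_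
          rw [← Finset.prod_const]
          refine Finset.prod_congr rfl fun v hv => ?_
          rw [hZ z hz v hv]
          rcases hε v hv with h | h <;> rw [h] <;> norm_num
      _ ≤ _ := Finset.sum_le_sum_of_subset_of_nonneg (Finset.subset_univ _)
          fun z _ _ => Finset.prod_nonneg fun v hv => hle v hv z
  refine hlow.trans ?_
  simp only [Finset.prod_one_add]
  rw [Finset.sum_comm]
  have hS : ∀ S ∈ V.powerset, ∑ z, ∏ v ∈ S, ((ε v : ℝ) * χ (z - v)) ≤
      (if S = ∅ then (p : ℝ) else 0) + 11 * V.card * √p := by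
    intro S hSV
    rw [Finset.mem_powerset] at hSV
    rcases S.eq_empty_or_nonempty with rfl | hne
    · simp [ZMod.card]
      positivity
    have e : ∑ z, ∏ v ∈ S, ((ε v : ℝ) * χ (z - v)) =
        (∏ v ∈ S, (ε v : ℝ)) * ∑ z, (χ ((rootPoly S).eval z) : ℝ) := by
      rw [Finset.mul_sum]
      refine Finset.sum_congr rfl fun z _ => ?_
      rw [Finset.prod_mul_distrib, rootPoly, eval_prod, map_prod, Int.cast_prod]
      simp
    have hcle := Finset.card_le_card hSV
    have hb := abs_sum_quadraticChar_rootPoly_le hp hne (fun h => h0 (hSV h)) (by omega)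
    have habs : |∏ v ∈ S, (ε v : ℝ)| = 1 := by
      rw [Finset.abs_prod]
      refine Finset.prod_eq_one fun v hv => ?_
      rcases hε v (hSV hv) with h | h <;> rw [h] <;> norm_num
    rw [e, if_neg hne.ne_empty, zero_add]
    refine (le_abs_self _).trans ?_
    rw [abs_mul, habs, one_mul]
    refine hb.trans ?_
    gcongr
  refine (Finset.sum_le_sum hS).trans ?_
  rw [Finset.sum_add_distrib, Finset.sum_ite_eq', if_pos (Finset.empty_mem_powerset V),
    Finset.sum_const, Finset.card_powerset, nsmul_eq_mul]
  norm_num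

end Stepanov

/-- The congruence is solvable with prime `h` and semiprime `k`, both at most `B`. -/
def HasClosePoints (p : ℕ) (c : ℤ) (B : ℕ) : Prop :=
  ∃ x y : ℤ, (x, y) ∈ ModularHyperbola p c ∧
    ∃ h k : ℕ, h.Prime ∧ (∃ q₁ q₂ : ℕ, q₁.Prime ∧ q₂.Prime ∧ q₁ ≠ q₂ ∧ k = q₁ * q₂) ∧
      h ≤ B ∧ k ≤ B ∧ (x + h) * (y + k) ≡ c [ZMOD p]

lemma HasClosePoints.of_modEq {p : ℕ} {c c' : ℤ} {B : ℕ} (h : HasClosePoints p c B)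
    (hc : c ≡ c' [ZMOD p]) : HasClosePoints p c' B := by
  obtain ⟨x, y, ⟨h1, h2, h3, h4, h5⟩, a, k, ha, hk, haB, hkB, hmod⟩ := h
  exact ⟨x, y, ⟨h1, h2, h3, h4, h5.trans hc⟩, a, k, ha, hk, haB, hkB, hmod.trans hc⟩

section Hyperbola

variable {p : ℕ} [Fact p.Prime]

lemma exists_mem_modularHyperbola (hp : 2 < p) {c : ℤ} (hc : (c : ZMod p) ≠ 0) {h k : ℕ}
    (hh : (h : ZMod p) ≠ 0) (hk : (k : ZMod p) ≠ 0)
    (hsq : IsSquare ((h * k : ZMod p) * (h * k - 4 * c))) :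
    ∃ x y : ℤ, (x, y) ∈ ModularHyperbola p c ∧ (x + h) * (y + k) ≡ c [ZMOD p] := by
  obtain ⟨w, hw⟩ := hsq
  have h2 : (2 : ZMod p) ≠ 0 := by
    intro h
    have h' : ((2 : ℕ) : ZMod p) = 0 := by exact_mod_cast h
    exact absurd (Nat.le_of_dvd two_pos ((ZMod.natCast_eq_zero_iff _ _).1 h')) (by omega)
  obtain ⟨x, hx⟩ : ∃ x : ZMod p, 2 * k * x = w - h * k :=
    ⟨(w - h * k) / (2 * k), by field_simp⟩
  have hquad : k * x ^ 2 + h * k * x + c * h = 0 := by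
    have : (4 * k : ZMod p) * (k * x ^ 2 + h * k * x + c * h) = 0 := by
      linear_combination (2 * k * x + w + h * k) * hx - hw
    refine (mul_eq_zero.1 this).resolve_left ?_
    rw [show (4 : ZMod p) = 2 * 2 by norm_num]
    exact mul_ne_zero (mul_ne_zero h2 h2) hk
  have hx0 : x ≠ 0 := by
    rintro rfl
    simp [hc, hh] at hquad
  have hp0 : (0 : ℤ) < p := by omega
  have hval : ∀ u : ZMod p, ((u.val : ℤ) : ZMod p) = u := fun u => by simp
  refine ⟨x.val, (c / x : ZMod p).val, ⟨by positivity, ?_, by positivity, ?_, ?_⟩, ?_⟩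
  · have := ZMod.val_lt x
    dsimp only; omega
  · have := ZMod.val_lt (c / x : ZMod p)
    dsimp only; omega
  · rw [← ZMod.intCast_eq_intCast_iff, Int.cast_mul, hval, hval]
    field_simp
  · rw [← ZMod.intCast_eq_intCast_iff, Int.cast_mul, Int.cast_add, Int.cast_add, hval, hval,
      Int.cast_natCast, Int.cast_natCast]
    field_simp
    linear_combination hquad

lemma exists_mem_modularHyperbola_prime_semiprime (hp : 2 < p) {c : ℤ} (hc : (c : ZMod p) ≠ 0) :
    ∃ x y : ℤ, (x, y) ∈ ModularHyperbola p c ∧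
      ∃ h k : ℕ, h.Prime ∧ (∃ q₁ q₂ : ℕ, q₁.Prime ∧ q₂.Prime ∧ q₁ ≠ q₂ ∧ k = q₁ * q₂) ∧
        (x + h) * (y + k) ≡ c [ZMOD p] := by
  have h2 : (2 : ZMod p) ≠ 0 := by
    intro h
    have h' : ((2 : ℕ) : ZMod p) = 0 := by exact_mod_cast h
    exact absurd (Nat.le_of_dvd two_pos ((ZMod.natCast_eq_zero_iff _ _).1 h')) (by omega)
  have h4 : (4 * c : ZMod p) ≠ 0 := by
    rw [show (4 : ZMod p) = 2 * 2 by norm_num]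
    exact mul_ne_zero (mul_ne_zero h2 h2) hc
  obtain ⟨h, -, hh, hhc⟩ := Nat.forall_exists_prime_gt_and_eq_mod h4.isUnit 0
  obtain ⟨q, -, hq, hq1⟩ := Nat.forall_exists_prime_gt_and_eq_mod (q := p) isUnit_one 0
  obtain ⟨r, hr, hr', hr1⟩ := Nat.forall_exists_prime_gt_and_eq_mod (q := p) isUnit_one q
  obtain ⟨x, y, hxy, hxy'⟩ := exists_mem_modularHyperbola (h := h) (k := q * r) hp hc
    (by rwa [hhc]) (by simp [hq1, hr1]) ⟨0, by simp [hq1, hr1, hhc]⟩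
  exact ⟨x, y, hxy, h, q * r, hh, ⟨q, r, hq, hr', hr.ne, rfl⟩, hxy'⟩

lemma exists_isSquare_of_prime_sets (hp : 100 ≤ p) {c : ZMod p} (hc : c ≠ 0) {V Q H : Finset ℕ}
    (hV : ∀ v ∈ V, v.Prime ∧ v < p) (hQ : ∀ q ∈ Q, q.Prime) (hH : ∀ h ∈ H, h.Prime)
    (hQH : Disjoint Q H) (hlt : ∀ q ∈ Q, ∀ h ∈ H, q * h < p) (hV8 : 8 * V.card ≤ p)
    (hVp : p ≤ 2 ^ V.card) (hcard : 1 + 11 * V.card * √(p : ℝ) < Q.card * H.card) :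
    ∃ v ∈ V, ∃ q ∈ Q, ∃ h ∈ H,
      IsSquare ((h * (q * v : ℕ) : ZMod p) * (h * (q * v : ℕ) - 4 * c)) := by
  classical
  by_contra! hcon
  have hne : ∀ n : ℕ, 0 < n → n < p → (n : ZMod p) ≠ 0 := fun n h0 hn h =>
    absurd (Nat.le_of_dvd h0 ((ZMod.natCast_eq_zero_iff _ _).1 h)) (by omega)
  have hinj : ∀ m n : ℕ, m < p → n < p → (m : ZMod p) = n → m = n := fun m n hm hn h => by
    rw [ZMod.natCast_eq_natCast_iff] at h
    exact Nat.ModEq.eq_of_lt_of_lt h hm hn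
  have h4 : (4 * c : ZMod p) ≠ 0 := mul_ne_zero (by exact_mod_cast hne 4 (by omega) (by omega)) hc
  have hu : ∀ q ∈ Q, ∀ h ∈ H, ((q * h : ℕ) : ZMod p) ≠ 0 := fun q hq h hh =>
    hne _ (Nat.mul_pos (hQ q hq).pos (hH h hh).pos) (hlt q hq h hh)
  set V' : Finset (ZMod p) := V.image (↑) with hV'
  have hV'card : V'.card = V.card := Finset.card_image_of_injOn fun a ha b hb hab =>
    hinj a b (hV a ha).2 (hV b hb).2 hab
  set Z : Finset (ZMod p) := (Q ×ˢ H).image fun u => 4 * c / (u.1 * u.2 : ℕ) with hZ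
  have hZcard : Z.card = Q.card * H.card := by
    rw [← Finset.card_product]
    refine Finset.card_image_of_injOn ?_
    rintro ⟨q, h⟩ hu1 ⟨q', h'⟩ hu2 heq
    obtain ⟨hq, hh⟩ := Finset.mem_product.1 (Finset.mem_coe.1 hu1)
    obtain ⟨hq', hh'⟩ := Finset.mem_product.1 (Finset.mem_coe.1 hu2)
    dsimp only at heq hq hh hq' hh'
    have e1 : ((q * h : ℕ) : ZMod p) = (q' * h' : ℕ) := by
      rw [div_eq_div_iff (hu q hq h hh) (hu q' hq' h' hh')] at heq
      exact (mul_left_cancel₀ h4 heq).symm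
    have e2 := hinj _ _ (hlt q hq h hh) (hlt q' hq' h' hh') e1
    have e3 : h = h' := by
      rcases (Nat.Prime.dvd_mul (hH h hh)).1 (e2 ▸ Dvd.intro_left q rfl : h ∣ q' * h') with hd | hd
      · rw [Nat.prime_dvd_prime_iff_eq (hH h hh) (hQ q' hq')] at hd
        exact absurd hq' (hd ▸ Finset.disjoint_right.1 hQH hh)
      · rwa [Nat.prime_dvd_prime_iff_eq (hH h hh) (hH h' hh')] at hd
    subst e3
    rw [Nat.eq_of_mul_eq_mul_right (hH h hh).pos e2]
  have h0 : (0 : ZMod p) ∉ V' := by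
    intro h
    obtain ⟨v, hv, hv0⟩ := Finset.mem_image.1 h
    exact hne v (hV v hv).1.pos (hV v hv).2 hv0
  have key := two_pow_mul_card_le_of_quadraticChar_eq hp h0 (by rwa [hV'card])
    (ε := fun v => -quadraticChar (ZMod p) (-v)) (fun v hv => by
      rcases quadraticChar_dichotomy (neg_ne_zero.2 fun h : v = 0 => h0 (h ▸ hv)) with h | h <;>
        simp [h]) Z fun z hz v hv => by
      obtain ⟨⟨q, h⟩, hu1, rfl⟩ := Finset.mem_image.1 hz
      obtain ⟨v, hvV, rfl⟩ := Finset.mem_image.1 hv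
      obtain ⟨hq, hh⟩ := Finset.mem_product.1 hu1
      have hn := quadraticChar_neg_one_iff_not_isSquare.2 (hcon v hvV q hq h hh)
      have hu0 := hu q hq h hh
      have e : (h * (q * v : ℕ) : ZMod p) * (h * (q * v : ℕ) - 4 * c) =
          (q * h : ℕ) ^ 2 * (-v * (4 * c / (q * h : ℕ) - v)) := by
        field_simp
        push_cast
        ring
      rw [e, map_mul, quadraticChar_sq_one' hu0, one_mul, map_mul] at hn
      have hv0 : (-v : ZMod p) ≠ 0 := neg_ne_zero.2 (hne v (hV v hvV).1.pos (hV v hvV).2)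
      dsimp only
      rcases quadraticChar_dichotomy hv0 with h' | h' <;> rw [h'] at hn ⊢ <;> linarith
  rw [hV'card, hZcard] at key
  have hp2 : (p : ℝ) ≤ 2 ^ V.card := by exact_mod_cast hVp
  have h2 : (0 : ℝ) < 2 ^ V.card := by positivity
  have : (2 : ℝ) ^ V.card * (1 + 11 * V.card * √(p : ℝ)) <
      2 ^ V.card * ((Q.card * H.card : ℕ) : ℝ) := by
    push_cast
    gcongr
  linarith

end Hyperbola

lemma le_two_mul_mul_primeCounting {n L : ℕ} (hn : 6 ≤ n) (hL : n < 2 ^ L) :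
    n ≤ 2 * L * n.primeCounting := by
  have h1 : (n + 1) ^ 2 ≤ 2 ^ n := by
    clear hL
    induction n, hn using Nat.le_induction with
    | base => norm_num
    | succ n hn ih => rw [pow_succ 2]; nlinarith
  have hl2 : 0 < Real.log 2 := Real.log_pos one_lt_two
  have h2 : 2 * Real.log (n + 1) ≤ n * Real.log 2 := by
    have := Real.log_le_log (by positivity) (by exact_mod_cast h1 : ((n : ℝ) + 1) ^ 2 ≤ 2 ^ n)
    simpa using this
  have h3 : Real.log n ≤ L * Real.log 2 := by
    have := Real.log_le_log (by positivity) (by exact_mod_cast hL.le : (n : ℝ) ≤ 2 ^ L)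
    simpa using this
  have h4 := Chebyshev.pi_ge n
  have hn0 : 0 < Real.log n := Real.log_pos (by exact_mod_cast (by omega : 1 < n))
  rw [div_le_iff₀ hn0] at h4
  have h5 : (n.primeCounting : ℝ) * Real.log n ≤ n.primeCounting * (L * Real.log 2) := by gcongr
  have h6 : (n : ℝ) * Real.log 2 ≤ (2 * L * n.primeCounting) * Real.log 2 := by linarith
  exact_mod_cast le_of_mul_le_mul_right h6 hl2

lemma hasClosePoints_of_large {p L t : ℕ} [Fact p.Prime] {c : ℤ}
    (hc : (c : ZMod p) ≠ 0) (hL : L = Nat.log 2 p + 1) (ht : t = p.sqrt.sqrt + 1)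
    (hL8 : 8 ≤ L) (hLp : 4 * L ^ 13 < p.sqrt) :
    HasClosePoints p c (t * L ^ 8) := by
  have hpL : p < 2 ^ L := hL ▸ Nat.lt_pow_succ_log_self one_lt_two p
  have hsp := Nat.sqrt_le p
  have hLpos : 0 < L := by omega
  have hp100 : 100 ≤ p := by
    have : 1 * 8 ^ 13 ≤ 4 * L ^ 13 := Nat.mul_le_mul (by norm_num) (Nat.pow_le_pow_left hL8 13)
    have := Nat.sqrt_le_self p
    omega
  have hLt : L ≤ t := by
    have : L ≤ p.sqrt.sqrt := by
      rw [Nat.le_sqrt]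
      have : L ^ 2 ≤ L ^ 13 := Nat.pow_le_pow_right hLpos (by norm_num)
      nlinarith
    omega
  have hts : p.sqrt + 1 ≤ t ^ 2 := ht ▸ Nat.lt_succ_sqrt' p.sqrt
  have htp : √(p : ℝ) ≤ (t : ℝ) ^ 2 := by
    have e1 : √(p : ℝ) ≤ p.sqrt + 1 := by
      rw [Real.sqrt_le_left (by positivity)]
      exact_mod_cast (Nat.lt_succ_sqrt' p).le
    exact e1.trans (by exact_mod_cast hts)
  have hXY : t * L ^ 5 * (t * L ^ 8) < p := by
    have e0 := Nat.sqrt_le p.sqrt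
    have e1 : 1 ≤ p.sqrt.sqrt := by
      rw [Nat.le_sqrt]; omega
    have e2 : t ^ 2 ≤ 4 * p.sqrt := by rw [ht]; nlinarith
    calc t * L ^ 5 * (t * L ^ 8) = t ^ 2 * L ^ 13 := by ring
      _ ≤ 4 * p.sqrt * L ^ 13 := Nat.mul_le_mul_right _ e2
      _ = p.sqrt * (4 * L ^ 13) := by ring
      _ < p.sqrt * p.sqrt := Nat.mul_lt_mul_of_pos_left hLp (by omega)
      _ ≤ p := hsp
  have htpos : 0 < t := by omega
  have hpow : ∀ n, 0 < t * L ^ n := fun n => by positivity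
  have hX : t * L ^ 8 < p := lt_of_le_of_lt (Nat.le_mul_of_pos_left _ (hpow 5)) hXY
  have hY : t * L ^ 5 < p := lt_of_le_of_lt (Nat.le_mul_of_pos_right _ (hpow 8)) hXY
  have hWY : L ^ 3 ≤ t * L ^ 3 := Nat.le_mul_of_pos_left _ htpos
  have h3 : 8 ^ 3 ≤ L ^ 3 := Nat.pow_le_pow_left hL8 3
  have hYW : t * L ^ 3 ≤ t * L ^ 5 := by gcongr; omega
  have hYX : t * L ^ 5 ≤ t * L ^ 8 := by gcongr; omega
  have hπ : ∀ n, 6 ≤ n → n < p → n ≤ 2 * L * (Nat.primesLE n).card := fun n h1 h2 => by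
    rw [Nat.primesLE_card_eq_primeCounting]
    exact le_two_mul_mul_primeCounting h1 (h2.trans hpL)
  have hπle : ∀ n, (Nat.primesLE n).card ≤ n := fun n => by
    rw [Nat.primesLE_eq_filter_Icc_one]
    exact (Finset.card_filter_le _ _).trans (by simp)
  have hVcard : L ≤ (Nat.primesLE (L ^ 3)).card := by
    have := hπ (L ^ 3) (by omega) (by omega)
    have e : L * (L * L) ≤ L * (2 * (Nat.primesLE (L ^ 3)).card) := by
      calc L * (L * L) = L ^ 3 := by ring
        _ ≤ _ := this
        _ = _ := by ring
    have := Nat.le_of_mul_le_mul_left e hLpos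
    nlinarith
  obtain ⟨V, hVsub, hV⟩ := Finset.exists_subset_card_eq hVcard
  have hcount : ∀ n m, 6 ≤ t * L ^ (n + 2) → t * L ^ (n + 2) < p → m ≤ t * L ^ n →
      t * L ^ n ≤ (Nat.primesLE (t * L ^ (n + 2)) \ Nat.primesLE m).card := by
    intro n m h6 hlt hm
    have e1 := hπ _ h6 hlt
    have e2 := Finset.le_card_sdiff (Nat.primesLE m) (Nat.primesLE (t * L ^ (n + 2)))
    have e3 := hπle m
    have e4 : L * (L * (t * L ^ n)) ≤ L * (2 * (Nat.primesLE (t * L ^ (n + 2))).card) := by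
      calc L * (L * (t * L ^ n)) = t * L ^ (n + 2) := by ring
        _ ≤ _ := e1
        _ = _ := by ring
    have e5 := Nat.le_of_mul_le_mul_left e4 hLpos
    have e6 : 8 * (t * L ^ n) ≤ L * (t * L ^ n) := Nat.mul_le_mul_right _ hL8
    omega
  have hQ := hcount 3 (L ^ 3) (by simp only [Nat.reduceAdd]; omega) hY hWY
  have hH := hcount 6 (t * L ^ 5) (by simp only [Nat.reduceAdd]; omega) hX
    (by gcongr; omega)
  simp only [Nat.reduceAdd] at hQ hH
  set Q := Nat.primesLE (t * L ^ 5) \ Nat.primesLE (L ^ 3)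
  set H := Nat.primesLE (t * L ^ 8) \ Nat.primesLE (t * L ^ 5)
  have hQm : ∀ q ∈ Q, q.Prime ∧ q ≤ t * L ^ 5 ∧ L ^ 3 < q := fun q hq => by
    simp only [Q, Finset.mem_sdiff, Nat.mem_primesLE] at hq
    exact ⟨hq.1.2, hq.1.1, by by_contra! h; exact hq.2 ⟨h, hq.1.2⟩⟩
  have hHm : ∀ q ∈ H, q.Prime ∧ q ≤ t * L ^ 8 ∧ t * L ^ 5 < q := fun q hq => by
    simp only [H, Finset.mem_sdiff, Nat.mem_primesLE] at hq
    exact ⟨hq.1.2, hq.1.1, by by_contra! h; exact hq.2 ⟨h, hq.1.2⟩⟩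
  have hVm : ∀ v ∈ V, v.Prime ∧ v ≤ L ^ 3 := fun v hv =>
    (Nat.mem_primesLE.1 (hVsub hv)).symm
  have hcard : 1 + 11 * V.card * √(p : ℝ) < Q.card * H.card := by
    rw [hV]
    have e1 : (t * L ^ 3 : ℝ) * (t * L ^ 6) ≤ Q.card * H.card := by
      exact_mod_cast Nat.mul_le_mul hQ hH
    have e2 : √(p : ℝ) * L ^ 9 ≤ t ^ 2 * (L : ℝ) ^ 9 := by gcongr
    have e3 : (1 : ℝ) ≤ √p := Real.le_sqrt_of_sq_le (by norm_num; omega)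
    have e4 : (12 * L : ℝ) < L ^ 9 := by
      have : 12 * L < L ^ 9 := by
        have : 8 ^ 8 ≤ L ^ 8 := Nat.pow_le_pow_left hL8 8
        rw [pow_succ]
        nlinarith
      exact_mod_cast this
    have e5 : √(p : ℝ) * (12 * L) < √(p : ℝ) * L ^ 9 := by gcongr
    have e6 : (1 : ℝ) ≤ L := by exact_mod_cast hLpos
    nlinarith
  obtain ⟨v, hv, q, hq, h, hh, hsq⟩ := exists_isSquare_of_prime_sets hp100 hc (V := V) (Q := Q)
    (H := H) (fun v hv => ⟨(hVm v hv).1, (hVm v hv).2.trans_lt (by omega)⟩)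
    (fun q hq => (hQm q hq).1) (fun h hh => (hHm h hh).1)
    (Finset.disjoint_left.2 fun q hq hh => absurd (hQm q hq).2.1 (hHm q hh).2.2.not_ge)
    (fun q hq h hh => (Nat.mul_le_mul (hQm q hq).2.1 (hHm h hh).2.1).trans_lt hXY)
    (by have : L ^ 1 ≤ L ^ 13 := Nat.pow_le_pow_right hLpos (by norm_num)
        nlinarith)
    (by rw [hV]; exact hpL.le) hcard
  have hk : q * v ≤ t * L ^ 8 :=
    (Nat.mul_le_mul (hQm q hq).2.1 (hVm v hv).2).trans_eq (by ring)
  have hne : ∀ n : ℕ, 0 < n → n < p → (n : ZMod p) ≠ 0 := fun n h0 hn h =>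
    absurd (Nat.le_of_dvd h0 ((ZMod.natCast_eq_zero_iff _ _).1 h)) (by omega)
  obtain ⟨x, y, hxy, hxy'⟩ := exists_mem_modularHyperbola (by omega) hc
    (hne h (hHm h hh).1.pos ((hHm h hh).2.1.trans_lt hX))
    (hne (q * v) (Nat.mul_pos (hQm q hq).1.pos (hVm v hv).1.pos) (hk.trans_lt hX)) hsq
  exact ⟨x, y, hxy, h, q * v, (hHm h hh).1, ⟨q, v, (hQm q hq).1, (hVm v hv).1,
    ((hVm v hv).2.trans_lt (hQm q hq).2.2).ne', rfl⟩, (hHm h hh).2.1, hk, hxy'⟩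

open Filter in
lemma eventually_log_pow_lt_sqrt :
    ∀ᶠ p : ℕ in atTop, 8 ≤ Nat.log 2 p + 1 ∧ 4 * (Nat.log 2 p + 1) ^ 13 < p.sqrt := by
  have h1 : ∀ᶠ n : ℕ in atTop, 50 * n ^ 26 ≤ 2 ^ n := by
    have := (isLittleO_pow_const_const_pow_of_one_lt (R := ℝ) 26 one_lt_two).bound
      (show (0 : ℝ) < 1 / 50 by norm_num)
    filter_upwards [this] with n hn
    simp only [norm_pow, Real.norm_natCast, Real.norm_ofNat] at hn
    have : (50 * n ^ 26 : ℝ) ≤ 2 ^ n := by linarith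
    exact_mod_cast this
  obtain ⟨N, hN⟩ := eventually_atTop.1 h1
  filter_upwards [eventually_ge_atTop (2 ^ (N + 8))] with p hp
  have hp0 : p ≠ 0 := (Nat.two_pow_pos (N + 8) |>.trans_le hp).ne'
  have hlog : N + 8 ≤ Nat.log 2 p := Nat.le_log_of_pow_le one_lt_two hp
  refine ⟨by omega, Nat.le_sqrt.2 ?_⟩
  have h2 := hN (Nat.log 2 p + 1) (by omega)
  have h3 := Nat.pow_log_le_self 2 hp0
  set L := Nat.log 2 p + 1 with hL
  have h4 : 1 ≤ L ^ 13 := Nat.one_le_pow _ _ (by omega)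
  have h5 : L ^ 26 = L ^ 13 * L ^ 13 := by ring
  have h6 : 2 ^ L = 2 ^ Nat.log 2 p * 2 := pow_succ 2 _
  nlinarith

lemma sqrt_sqrt_mul_log_pow_le {p : ℕ} (hp : 3 ≤ p) {ε : ℝ} (hε : 0 < ε) :
    (((p.sqrt.sqrt + 1) * (Nat.log 2 p + 1) ^ 8 : ℕ) : ℝ) ≤
      (2 * 3 ^ 8 * (Nat.factorial 16 : ℝ)) * (p : ℝ) ^ ((1 : ℝ) / 4) *
        Real.exp ((Real.log p) ^ ((1 : ℝ) / 2 + ε)) := by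
  have hp1 : (1 : ℝ) ≤ p := by exact_mod_cast (by omega : 1 ≤ p)
  have hlog : 1 ≤ Real.log p := by
    rw [Real.le_log_iff_exp_le (by positivity)]
    have : (3 : ℝ) ≤ p := by exact_mod_cast hp
    linarith [Real.exp_one_lt_d9]
  have ht : ((p.sqrt.sqrt + 1 : ℕ) : ℝ) ≤ 2 * (p : ℝ) ^ ((1 : ℝ) / 4) := by
    have h1 : (1 : ℝ) ≤ (p : ℝ) ^ ((1 : ℝ) / 4) := Real.one_le_rpow hp1 (by norm_num)
    have h2 : (p.sqrt.sqrt : ℝ) ≤ (p : ℝ) ^ ((1 : ℝ) / 4) := by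
      have e : (p.sqrt.sqrt) ^ 4 ≤ p := by
        calc p.sqrt.sqrt ^ 4 = (p.sqrt.sqrt ^ 2) ^ 2 := by ring
          _ ≤ p.sqrt ^ 2 := Nat.pow_le_pow_left (Nat.sqrt_le' _) 2
          _ ≤ p := Nat.sqrt_le' _
      have e' : (p.sqrt.sqrt : ℝ) ^ 4 ≤ p := by exact_mod_cast e
      calc (p.sqrt.sqrt : ℝ) = ((p.sqrt.sqrt : ℝ) ^ 4) ^ ((1 : ℝ) / 4) := by
            rw [← Real.rpow_natCast, ← Real.rpow_mul (by positivity)]; norm_num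
        _ ≤ _ := by gcongr
    push_cast
    linarith
  have hL : ((Nat.log 2 p + 1 : ℕ) : ℝ) ≤ 3 * Real.log p := by
    have h1 := Real.log_le_log (by positivity)
      (by exact_mod_cast Nat.pow_log_le_self 2 (by omega : p ≠ 0) :
        (2 : ℝ) ^ Nat.log 2 p ≤ p)
    rw [Real.log_pow] at h1
    have h2 := Real.log_two_gt_d9
    have h3 : (Nat.log 2 p : ℝ) * (1 / 2) ≤ Nat.log 2 p * Real.log 2 := by gcongr; linarith
    push_cast
    linarith
  have hexp : Real.log p ^ 8 ≤
      (Nat.factorial 16 : ℝ) * Real.exp ((Real.log p) ^ ((1 : ℝ) / 2 + ε)) := by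
    set y := Real.log p ^ ((1 : ℝ) / 2) with hy
    have hy0 : 0 ≤ y := by positivity
    have e : Real.log p ^ 8 = y ^ 16 := by
      rw [hy, ← Real.rpow_natCast, ← Real.rpow_natCast, ← Real.rpow_mul (by positivity)]
      norm_num
    have h1 := Real.pow_div_factorial_le_exp y hy0 16
    rw [div_le_iff₀ (by positivity)] at h1
    have h2 : y ≤ Real.log p ^ ((1 : ℝ) / 2 + ε) :=
      Real.rpow_le_rpow_of_exponent_le hlog (by linarith)
    rw [e, mul_comm]
    refine h1.trans ?_
    gcongr
  calc (((p.sqrt.sqrt + 1) * (Nat.log 2 p + 1) ^ 8 : ℕ) : ℝ)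
      = ((p.sqrt.sqrt + 1 : ℕ) : ℝ) * ((Nat.log 2 p + 1 : ℕ) : ℝ) ^ 8 := by push_cast; ring
    _ ≤ (2 * (p : ℝ) ^ ((1 : ℝ) / 4)) * (3 * Real.log p) ^ 8 := by gcongr
    _ = (2 * 3 ^ 8 * (p : ℝ) ^ ((1 : ℝ) / 4)) * Real.log p ^ 8 := by ring
    _ ≤ (2 * 3 ^ 8 * (p : ℝ) ^ ((1 : ℝ) / 4)) *
        ((Nat.factorial 16 : ℝ) * Real.exp ((Real.log p) ^ ((1 : ℝ) / 2 + ε))) := by gcongr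
    _ = _ := by ring

/-- For bounded `p`, solutions exist with a uniform bound. -/
lemma exists_hasClosePoints_of_lt (N : ℕ) :
    ∃ B : ℕ, ∀ p < N, p.Prime → 2 < p → ∀ c : ℤ, (c : ZMod p) ≠ 0 → HasClosePoints p c B := by
  have hex : ∀ p c : ℕ, ∃ B : ℕ, p.Prime → 2 < p → ((c : ℤ) : ZMod p) ≠ 0 →
      ∀ B' ≥ B, HasClosePoints p c B' := by
    intro p c
    by_cases h : p.Prime ∧ 2 < p ∧ ((c : ℤ) : ZMod p) ≠ 0
    · have : Fact p.Prime := ⟨h.1⟩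
      obtain ⟨x, y, hxy, a, k, ha, hk, hmod⟩ :=
        exists_mem_modularHyperbola_prime_semiprime h.2.1 h.2.2
      exact ⟨a + k, fun _ _ _ B' hB' =>
        ⟨x, y, hxy, a, k, ha, hk, by omega, by omega, hmod⟩⟩
    · exact ⟨0, fun h1 h2 h3 => absurd ⟨h1, h2, h3⟩ h⟩
  choose B hB using hex
  refine ⟨∑ p ∈ Finset.range N, ∑ c ∈ Finset.range p, B p c, fun p hpN hp h2 c hc => ?_⟩
  have hp0 : (0 : ℤ) < p := by omega
  obtain ⟨n, hn⟩ := Int.eq_ofNat_of_zero_le (Int.emod_nonneg c hp0.ne')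
  have hnp : n < p := by
    have := Int.emod_lt_of_pos c hp0
    omega
  have hmod : (n : ℤ) ≡ c [ZMOD p] := hn ▸ Int.mod_modEq c p
  have hle : B p n ≤ ∑ p ∈ Finset.range N, ∑ c ∈ Finset.range p, B p c :=
    (Finset.single_le_sum (f := fun c => B p c) (fun _ _ => Nat.zero_le _)
      (Finset.mem_range.2 hnp)).trans
    (Finset.single_le_sum (f := fun p => ∑ c ∈ Finset.range p, B p c) (fun _ _ => Nat.zero_le _)
      (Finset.mem_range.2 hpN))
  exact (hB p n hp h2 (by rwa [(ZMod.intCast_eq_intCast_iff _ _ _).2 hmod]) _ hle).of_modEq hmod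

/-- For every `ε > 0` there is `C_ε > 0` such that for every prime `p > 2` and every `c`
coprime to `p`, there are a point `(x, y) ∈ H_p^c`, a prime `h`, and a product of two
distinct primes `k`, both at most `C_ε p^{1/4} exp((log p)^{1/2+ε})`, with
`(x + h)(y + k) ≡ c (mod p)`. -/
theorem modular_hyperbola_close_points_prime_and_semiprime :
    ∀ ε : ℝ, 0 < ε →
    ∃ C : ℝ, 0 < C ∧
      ∀ p : ℕ, p.Prime → 2 < p → ∀ c : ℤ, Int.gcd c (p : ℤ) = 1 →
        ∃ x y : ℤ, (x, y) ∈ ModularHyperbola p c ∧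
          ∃ h k : ℕ, h.Prime ∧ (∃ q₁ q₂ : ℕ, q₁.Prime ∧ q₂.Prime ∧ q₁ ≠ q₂ ∧ k = q₁ * q₂) ∧
            1 ≤ h ∧ (h : ℝ) ≤ C * (p : ℝ) ^ ((1 : ℝ) / 4) *
                Real.exp ((Real.log p) ^ ((1 : ℝ) / 2 + ε)) ∧
            1 ≤ k ∧ (k : ℝ) ≤ C * (p : ℝ) ^ ((1 : ℝ) / 4) *
                Real.exp ((Real.log p) ^ ((1 : ℝ) / 2 + ε)) ∧
            (x + (h : ℤ)) * (y + (k : ℤ)) ≡ c [ZMOD (p : ℤ)] := by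
  intro ε hε
  obtain ⟨N, hN⟩ := Filter.eventually_atTop.1 eventually_log_pow_lt_sqrt
  obtain ⟨B, hB⟩ := exists_hasClosePoints_of_lt N
  refine ⟨2 * 3 ^ 8 * (Nat.factorial 16 : ℝ) + B, by positivity, fun p hp h2 c hc => ?_⟩
  have : Fact p.Prime := ⟨hp⟩
  have hc0 : (c : ZMod p) ≠ 0 := by
    rw [Ne, ZMod.intCast_zmod_eq_zero_iff_dvd]
    intro h
    have h1 := Int.dvd_coe_gcd h dvd_rfl
    rw [hc] at h1
    exact hp.one_lt.ne' (Nat.dvd_one.1 (by exact_mod_cast h1))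
  obtain ⟨D, hD, x, y, hxy, h, k, hh, hk, hhD, hkD, hmod⟩ :
      ∃ D : ℕ, (D : ℝ) ≤ (2 * 3 ^ 8 * (Nat.factorial 16 : ℝ) + B) * (p : ℝ) ^ ((1 : ℝ) / 4) *
        Real.exp ((Real.log p) ^ ((1 : ℝ) / 2 + ε)) ∧ HasClosePoints p c D := by
    have hp1 : (1 : ℝ) ≤ p := by exact_mod_cast hp.one_lt.le
    rcases lt_or_ge p N with hpN | hpN
    · refine ⟨B, ?_, hB p hpN hp h2 c hc0⟩
      have e1 : (1 : ℝ) ≤ (p : ℝ) ^ ((1 : ℝ) / 4) := Real.one_le_rpow hp1 (by norm_num)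
      have e2 : 1 ≤ Real.exp ((Real.log p) ^ ((1 : ℝ) / 2 + ε)) :=
        Real.one_le_exp (Real.rpow_nonneg (Real.log_nonneg hp1) _)
      calc (B : ℝ) = B * 1 * 1 := by ring
        _ ≤ _ := by gcongr; linarith
    · refine ⟨_, (sqrt_sqrt_mul_log_pow_le h2 hε).trans ?_,
        hasClosePoints_of_large hc0 rfl rfl (hN p hpN).1 (hN p hpN).2⟩
      gcongr
      simp
  obtain ⟨q₁, q₂, hq₁, hq₂, hne, rfl⟩ := hk
  exact ⟨x, y, hxy, h, q₁ * q₂, hh, ⟨q₁, q₂, hq₁, hq₂, hne, rfl⟩, hh.one_lt.le,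
    (Nat.cast_le.2 hhD).trans hD, Nat.mul_pos hq₁.pos hq₂.pos, (Nat.cast_le.2 hkD).trans hD, hmod⟩
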